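/- arXiv:2206.10580 — 10 statements merged into one kernel-verified Lean document; each statement's English description precedes it below -/
import Mathlib

section
/- Let D be the unique ℂ-linear derivation of the free algebra A with D(u) = −u² + 2·v·u − 2z·u + κ₂·1 and D(v) = −v² + v·u + u·v + 2z·v + κ₃·1 (the auxiliary autonomous system of the non-abelian Painlevé-4 system ¹P₄). Then the Okamoto element J = v²·u − u·v·u − κ₃·u + κ₂·v − 2z·v·u satisfies D(J) = 0. -/
/-- The free associative unital algebra over ℂ on two generators. -/
noncomputable abbrev A : Type := FreeAlgebra ℂ (Fin 2)

/-- The first generator `u` of the free algebra. -/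
noncomputable def u : A := FreeAlgebra.ι ℂ (0 : Fin 2)

/-- The second generator `v` of the free algebra. -/
noncomputable def v : A := FreeAlgebra.ι ℂ (1 : Fin 2)

theorem okamoto_integral_P4_1 (κ₂ κ₃ z : ℂ)
    (D : A →ₗ[ℂ] A)
    (hLeibniz : ∀ a b : A, D (a * b) = D a * b + a * D b)
    (hDu : D u =
      -u^2 + 2 * (v*u) - (2*z) • u + κ₂ • (1 : A))
    (hDv : D v =
      -v^2 + v*u + u*v + (2*z) • v + κ₃ • (1 : A))
    : D (v^2*u - u*v*u - κ₃ • u + κ₂ • v - (2*z) • (v*u)) = 0 := by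
  simp only [map_add, map_sub, map_smul, hLeibniz, hDu, hDv, pow_two, two_mul, mul_add, add_mul,
    mul_sub, sub_mul, neg_mul, mul_neg, mul_assoc, smul_mul_assoc, mul_smul_comm, mul_one, one_mul]
  module
end

section
/- Let D be the unique ℂ-linear derivation of the free algebra A with D(u) = −u² + 2·v·u − 2z·u + κ₂·1 and D(v) = −v² + 2·v·u + 2z·v + κ₃·1 (the auxiliary autonomous system of the non-abelian Painlevé-4 system ²P₄). Then the Okamoto element J = v²·u − v·u² − κ₃·u + κ₂·v − 2z·v·u satisfies D(J) = 0. -/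
theorem okamoto_integral_P4_2 (κ₂ κ₃ z : ℂ)
    (D : A →ₗ[ℂ] A)
    (hLeibniz : ∀ a b : A, D (a * b) = D a * b + a * D b)
    (hDu : D u =
      -u^2 + 2 * (v*u) - (2*z) • u + κ₂ • (1 : A))
    (hDv : D v =
      -v^2 + 2 * (v*u) + (2*z) • v + κ₃ • (1 : A))
    : D (v^2*u - v*u^2 - κ₃ • u + κ₂ • v - (2*z) • (v*u)) = 0 := by
  simp only [pow_two, map_sub, map_add, map_smul, hLeibniz, hDu, hDv, two_mul (v * u)]
  simp only [mul_add, add_mul, mul_sub, sub_mul, mul_neg, neg_mul, smul_mul_assoc,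
    mul_smul_comm, mul_one, one_mul, mul_assoc]
  module
end

section
/- Let D be the unique ℂ-linear derivation of the free algebra A with D(u) = −u² + u·v + v·u − 2z·u + κ₂·1 and D(v) = −v² + 2·u·v + 2z·v + κ₃·1 (the auxiliary autonomous system of the non-abelian Painlevé-4 system ³P₄). Then the Okamoto element J = v·u·v − u²·v − κ₃·u + κ₂·v − 2z·u·v satisfies D(J) = 0. -/
theorem okamoto_integral_P4_3 (κ₂ κ₃ z : ℂ)
    (D : A →ₗ[ℂ] A)
    (hLeibniz : ∀ a b : A, D (a * b) = D a * b + a * D b)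
    (hDu : D u =
      -u^2 + u*v + v*u - (2*z) • u + κ₂ • (1 : A))
    (hDv : D v =
      -v^2 + 2 * (u*v) + (2*z) • v + κ₃ • (1 : A))
    : D (v*u*v - u^2*v - κ₃ • u + κ₂ • v - (2*z) • (u*v)) = 0 := by
  simp only [map_add, map_sub, map_smul, hLeibniz, pow_two, hDu, hDv, two_mul, mul_add, add_mul,
    mul_sub, sub_mul, neg_mul, mul_neg, smul_mul_assoc, mul_smul_comm, one_mul, mul_one, mul_assoc]
  module
end

section
/- Assume κ₂ ≠ 0. Let D be the unique ℂ-linear derivation of the free algebra A with D(u) = 2·u·v·u + κ₁·u + κ₂·u² + κ₄·z·1 and D(v) = −2·v·u·v − κ₁·v − 2κ₂·v·u − κ₃·1 (the auxiliary autonomous system of the non-abelian Painlevé-3′ system ¹P₃′). Then the Okamoto element J = v·u²·v + κ₁·v·u + (κ₃/κ₂)·(u·v − v·u) + κ₂·v·u² + κ₃·u + κ₄·z·v satisfies D(J) = 0. -/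
theorem okamoto_integral_P3_1 (κ₁ κ₂ κ₃ κ₄ z : ℂ)
    (hκ₂ : κ₂ ≠ 0)
    (D : A →ₗ[ℂ] A)
    (hLeibniz : ∀ a b : A, D (a * b) = D a * b + a * D b)
    (hDu : D u =
      2 * (u*v*u) + κ₁ • u + κ₂ • u^2 + (κ₄*z) • (1 : A))
    (hDv : D v =
      -(2 * (v*u*v)) - κ₁ • v - (2*κ₂) • (v*u) - κ₃ • (1 : A))
    : D (v*u^2*v + κ₁ • (v*u) + (κ₃/κ₂) • (u*v - v*u) + κ₂ • (v*u^2) + κ₃ • u + (κ₄*z) • v) = 0 := by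
  obtain ⟨c, rfl⟩ : ∃ c, κ₃ = c * κ₂ := ⟨κ₃ / κ₂, (div_mul_cancel₀ κ₃ hκ₂).symm⟩
  rw [mul_div_cancel_right₀ c hκ₂]
  simp only [map_add, map_sub, map_smul, pow_two, hLeibniz, hDu, hDv, two_mul, mul_add, add_mul,
    mul_sub, sub_mul, mul_neg, neg_mul, smul_mul_assoc, mul_smul_comm, mul_one, one_mul, mul_assoc]
  module
end

section
/- Let D be the unique ℂ-linear derivation of the free algebra A with D(u) = 2·v·u² + κ₁·u + κ₂·u² + κ₄·z·1 and D(v) = −2·v²·u − κ₁·v − 2κ₂·v·u − κ₃·1 (the auxiliary autonomous system of the non-abelian Painlevé-3′ system ³P₃′). Then the Okamoto element J = v²·u² + κ₁·v·u + κ₂·v·u² + κ₃·u + κ₄·z·v satisfies D(J) = 0. -/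
theorem okamoto_integral_P3_3 (κ₁ κ₂ κ₃ κ₄ z : ℂ)
    (D : A →ₗ[ℂ] A)
    (hLeibniz : ∀ a b : A, D (a * b) = D a * b + a * D b)
    (hDu : D u =
      2 * (v*u^2) + κ₁ • u + κ₂ • u^2 + (κ₄*z) • (1 : A))
    (hDv : D v =
      -(2 * (v^2*u)) - κ₁ • v - (2*κ₂) • (v*u) - κ₃ • (1 : A))
    : D (v^2*u^2 + κ₁ • (v*u) + κ₂ • (v*u^2) + κ₃ • u + (κ₄*z) • v) = 0 := by
  simp only [map_add, map_smul, pow_two, hLeibniz, hDu, hDv]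
  simp only [two_mul, mul_add, add_mul, mul_sub, sub_mul, mul_neg, neg_mul, smul_mul_assoc,
    mul_smul_comm, mul_one, one_mul, smul_add, smul_sub, smul_neg, mul_assoc]
  module
end

section
/- Let D be the unique ℂ-linear derivation of the free algebra A with D(u) = u·v·u + v·u² + κ₁·u + κ₂·u² + κ₄·z·1 and D(v) = −v·u·v − v²·u − κ₁·v − κ₂·u·v − κ₂·v·u − κ₃·1 (the auxiliary autonomous system of the non-abelian Painlevé-3′ system ⁴P₃′). Then the Okamoto element J = v·u·v·u + κ₁·v·u + κ₂·u·v·u + κ₃·u + κ₄·z·v satisfies D(J) = 0. -/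
theorem okamoto_integral_P3_4 (κ₁ κ₂ κ₃ κ₄ z : ℂ)
    (D : A →ₗ[ℂ] A)
    (hLeibniz : ∀ a b : A, D (a * b) = D a * b + a * D b)
    (hDu : D u =
      u*v*u + v*u^2 + κ₁ • u + κ₂ • u^2 + (κ₄*z) • (1 : A))
    (hDv : D v =
      -(v*u*v) - v^2*u - κ₁ • v - κ₂ • (u*v) - κ₂ • (v*u) - κ₃ • (1 : A))
    : D (v*u*v*u + κ₁ • (v*u) + κ₂ • (u*v*u) + κ₃ • u + (κ₄*z) • v) = 0 := by
  simp only [map_add, map_smul, hLeibniz, hDu, hDv]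
  simp only [pow_two, mul_add, add_mul, mul_sub, sub_mul, mul_neg, neg_mul, smul_mul_assoc,
    mul_smul_comm, mul_one, one_mul, mul_assoc]
  module
end

section
/- Let D be the unique ℂ-linear derivation of the free algebra A with D(u) = u²·v + u·v·u + κ₁·u + κ₂·u² + κ₄·z·1 and D(v) = −u·v² − v·u·v − κ₁·v − κ₂·u·v − κ₂·v·u − κ₃·1 (the auxiliary autonomous system of the non-abelian Painlevé-3′ system ⁶P₃′). Then the Okamoto element J = u·v·u·v + κ₁·u·v + κ₂·u·v·u + κ₃·u + κ₄·z·v satisfies D(J) = 0. -/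
theorem okamoto_integral_P3_6 (κ₁ κ₂ κ₃ κ₄ z : ℂ)
    (D : A →ₗ[ℂ] A)
    (hLeibniz : ∀ a b : A, D (a * b) = D a * b + a * D b)
    (hDu : D u =
      u^2*v + u*v*u + κ₁ • u + κ₂ • u^2 + (κ₄*z) • (1 : A))
    (hDv : D v =
      -(u*v^2) - v*u*v - κ₁ • v - κ₂ • (u*v) - κ₂ • (v*u) - κ₃ • (1 : A))
    : D (u*v*u*v + κ₁ • (u*v) + κ₂ • (u*v*u) + κ₃ • u + (κ₄*z) • v) = 0 := by
  simp only [map_add, map_smul, hLeibniz, hDu, hDv]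
  simp only [pow_two, mul_add, add_mul, mul_sub, sub_mul, mul_neg, neg_mul, smul_mul_assoc,
    mul_smul_comm, mul_one, one_mul, mul_assoc]
  module
end

section
/- Let D be the unique ℂ-linear derivation of the free algebra A with D(u) = 2·u·v·u + κ₁·u + κ₂·u² + κ₄·z·1 and D(v) = −2·v·u·v − κ₁·v − κ₂·u·v − κ₂·v·u − κ₃·1 (the auxiliary autonomous system of the non-abelian Hamiltonian Painlevé-3′ system P₃′ᴴ). Then the commutator I = u·v − v·u satisfies D(I) = 0. -/
theorem commutator_integral_P3H (κ₁ κ₂ κ₃ κ₄ z : ℂ)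
    (D : A →ₗ[ℂ] A)
    (hLeibniz : ∀ a b : A, D (a * b) = D a * b + a * D b)
    (hDu : D u =
      2 * (u*v*u) + κ₁ • u + κ₂ • u^2 + (κ₄*z) • (1 : A))
    (hDv : D v =
      -(2 * (v*u*v)) - κ₁ • v - κ₂ • (u*v) - κ₂ • (v*u) - κ₃ • (1 : A))
    : D (u*v - v*u) = 0 := by
  rw [map_sub, hLeibniz, hLeibniz, hDu, hDv]
  simp only [add_mul, mul_add, sub_mul, mul_sub, neg_mul, mul_neg, smul_mul_assoc,
    mul_smul_comm, one_mul, mul_one, two_mul, pow_two, mul_assoc]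
  abel
end

section
/- Let D be the unique ℂ-linear derivation of the free algebra A with D(u) = −u² + v − (z/2)·1 and D(v) = 2·u·v + κ₃·1 (the auxiliary autonomous system of the non-abelian Painlevé-2 system ¹P₂). Then the Okamoto element J = −u²·v + (1/2)·v² − κ₃·u − (z/2)·v satisfies D(J) = 0. -/
theorem okamoto_integral_P2_1 (κ₃ z : ℂ)
    (D : A →ₗ[ℂ] A)
    (hLeibniz : ∀ a b : A, D (a * b) = D a * b + a * D b)
    (hDu : D u =
      -u^2 + v - (z/2) • (1 : A))
    (hDv : D v =
      2 * (u*v) + κ₃ • (1 : A))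
    : D (-(u^2*v) + (1/2 : ℂ) • v^2 - κ₃ • u - (z/2) • v) = 0 := by
  have two_mul_eq : (2 : A) * (u * v) = (2 : ℂ) • (u * v) := by
    rw [two_mul, two_smul]
  rw [two_mul_eq] at hDv
  simp only [map_sub, map_add, map_neg, map_smul, pow_two, hLeibniz, hDu, hDv,
    mul_add, add_mul, mul_sub, sub_mul, neg_mul, mul_neg, smul_mul_assoc, mul_smul_comm,
    one_mul, mul_one, mul_assoc]
  module
end

section
/- Let D be the unique ℂ-linear derivation of the free algebra A with D(u) = −u² + v − (z/2)·1 and D(v) = 2·v·u + κ₃·1 (the auxiliary autonomous system of the non-abelian Painlevé-2 system ²P₂). Then the Okamoto element J = −v·u² + (1/2)·v² − κ₃·u − (z/2)·v satisfies D(J) = 0. -/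
theorem okamoto_integral_P2_2 (κ₃ z : ℂ)
    (D : A →ₗ[ℂ] A)
    (hLeibniz : ∀ a b : A, D (a * b) = D a * b + a * D b)
    (hDu : D u =
      -u^2 + v - (z/2) • (1 : A))
    (hDv : D v =
      2 * (v*u) + κ₃ • (1 : A))
    : D (-(v*u^2) + (1/2 : ℂ) • v^2 - κ₃ • u - (z/2) • v) = 0 := by
  simp only [map_sub, map_add, map_neg, map_smul, pow_two, hLeibniz, hDu, hDv]
  generalize u = x
  generalize v = y
  simp only [two_mul, mul_add, add_mul, mul_sub, sub_mul, neg_mul, mul_neg, mul_smul_comm,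
    smul_mul_assoc, mul_one, one_mul, mul_assoc]
  module
end
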